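/- arXiv:2110.06705 — 3 statements merged into one kernel-verified Lean document; each statement's English description precedes it below -/
import Mathlib

section
/- Let E be a real inner product space, let U ⊆ E be a nonempty, compact, convex set, let β > 0, and let f : E → ℝ be twice continuously differentiable. Suppose that for every u ∈ U and every v ∈ E the second derivative of f satisfies f''(u)(v, v) ≥ β‖v‖² (i.e., the Hessian quadratic form at u is bounded below by β times the squared norm). Then f is β-strongly convex on U, and f attains a unique minimizer over U: there exists a unique û ∈ U such that f(û) ≤ f(u) for all u ∈ U. -/
/-- A `C²` function on a normed space whose second derivative is bounded below by `β‖v‖²` on a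
convex set is `β`-strongly convex there. -/
theorem strongConvexOn_of_le_iteratedFDeriv_two
    {E : Type*} [NormedAddCommGroup E] [NormedSpace ℝ E] {U : Set E} (hU : Convex ℝ U)
    {β : ℝ} {f : E → ℝ} (hf : ContDiff ℝ 2 f)
    (hHess : ∀ u ∈ U, ∀ v : E, β * ‖v‖ ^ 2 ≤ iteratedFDeriv ℝ 2 f u ![v, v]) :
    StrongConvexOn U β f := by
  refine ⟨hU, fun x hx y hy a b ha hb hab ↦ ?_⟩
  have hf₁ : Differentiable ℝ f := hf.differentiable two_ne_zero
  have hf₂ : Differentiable ℝ (fderiv ℝ f) :=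
    (hf.fderiv_right (m := 1) (by norm_num)).differentiable one_ne_zero
  have hline (t : ℝ) : HasDerivAt (fun s : ℝ ↦ y + s • (x - y)) (x - y) t := by
    simpa using ((hasDerivAt_id t).smul_const (x - y)).const_add y
  have hg₁ (t : ℝ) : HasDerivAt (fun s : ℝ ↦ f (y + s • (x - y)) - β / 2 * ‖x - y‖ ^ 2 * s ^ 2)
      (fderiv ℝ f (y + t • (x - y)) (x - y) - β * ‖x - y‖ ^ 2 * t) t := by
    refine (((hf₁ _).hasFDerivAt.comp_hasDerivAt t (hline t)).sub
      ((hasDerivAt_pow 2 t).const_mul (β / 2 * ‖x - y‖ ^ 2))).congr_deriv ?_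
    norm_num
    ring
  have hg₂ (t : ℝ) : HasDerivAt
      (fun s : ℝ ↦ fderiv ℝ f (y + s • (x - y)) (x - y) - β * ‖x - y‖ ^ 2 * s)
      (fderiv ℝ (fderiv ℝ f) (y + t • (x - y)) (x - y) (x - y) - β * ‖x - y‖ ^ 2) t := by
    have h := ((hf₂ _).hasFDerivAt.comp_hasDerivAt t (hline t)).clm_apply
      (hasDerivAt_const t (x - y))
    refine (h.sub ((hasDerivAt_id t).const_mul (β * ‖x - y‖ ^ 2))).congr_deriv ?_
    simp
  have hconv := convexOn_of_hasDerivWithinAt2_nonneg (convex_Icc (0 : ℝ) 1)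
    (fun t _ ↦ (hg₁ t).continuousAt.continuousWithinAt)
    (fun t _ ↦ (hg₁ t).hasDerivWithinAt) (fun t _ ↦ (hg₂ t).hasDerivWithinAt)
    (fun t ht ↦ by
      have h := hHess _ (hU.add_smul_sub_mem hy hx (interior_subset ht)) (x - y)
      rw [iteratedFDeriv_two_apply] at h
      exact sub_nonneg.2 h)
  have h := hconv.2 (Set.right_mem_Icc.2 zero_le_one) (Set.left_mem_Icc.2 zero_le_one) ha hb hab
  obtain rfl : b = 1 - a := by linarith
  have hpt : y + a • (x - y) = a • x + (1 - a) • y := by module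
  simp only [smul_eq_mul, mul_one, mul_zero, add_zero, one_smul, zero_smul, hpt,
    add_sub_cancel] at h ⊢
  linear_combination h

/-- If `f : E → ℝ` is twice continuously differentiable and its
second derivative satisfies `f''(u)(v,v) ≥ β‖v‖²` for all `u` in a nonempty
compact convex set `U` and all `v`, then `f` is `β`-strongly convex on `U`
and attains a unique minimizer over `U`. -/
theorem strong_convex_unique_minimizer
    {E : Type*} [NormedAddCommGroup E] [InnerProductSpace ℝ E]
    (U : Set E) (hUne : U.Nonempty) (hUcpt : IsCompact U) (hUconv : Convex ℝ U)
    (β : ℝ) (hβ : 0 < β)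
    (f : E → ℝ) (hf : ContDiff ℝ 2 f)
    (hHess : ∀ u ∈ U, ∀ v : E, β * ‖v‖ ^ 2 ≤ iteratedFDeriv ℝ 2 f u ![v, v]) :
    StrongConvexOn U β f ∧ ∃! uhat, uhat ∈ U ∧ ∀ u ∈ U, f uhat ≤ f u := by
  have hstrong := strongConvexOn_of_le_iteratedFDeriv_two hUconv hf hHess
  obtain ⟨uhat, hmem, hmin⟩ := hUcpt.exists_isMinOn hUne hf.continuous.continuousOn
  exact ⟨hstrong, uhat, ⟨hmem, hmin⟩, fun w ⟨hw, hwmin⟩ ↦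
    (hstrong.strictConvexOn hβ).eq_of_isMinOn hwmin hmin hw hmem⟩
end

section
/- Let T ∈ ℕ, let q : ℕ → ℝ, σ : ℕ → ℝ with σ_t ≥ 0, D₀ ≥ 0, and let q_max ∈ (0, 1) and B > 0 satisfy 0 < q_t ≤ q_max for all t, B ≥ D₀, and B ≥ σ_t for all t. Let ρ > 0 and let c ∈ ℕ with c ≥ 1 satisfy c ≥ ln( (q_max^{(T+2)·c} + ρ/B) / (1 + ρ/B) ) / ln(q_max). Let E : ℕ → ℝ satisfy E_0 ≤ q_0^{c} · D₀ and E_{t+1} ≤ q_{t+1}^{c} · (E_t + σ_t) for all t. Then E_t ≤ ρ for every t ∈ {0, 1, …, T}. -/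
/-- A sequence driven by contractions of factor at most `x` and perturbations of size at most `B`
is bounded by a geometric sum. -/
theorem le_mul_geom_sum_of_le_mul_add {x B : ℝ} {a σ E : ℕ → ℝ} (hx : 0 ≤ x) (hB : 0 ≤ B)
    (ha : ∀ t, 0 ≤ a t ∧ a t ≤ x) (hσ : ∀ t, σ t ≤ B) (hE0 : E 0 ≤ x * B)
    (hrec : ∀ t, E (t + 1) ≤ a (t + 1) * (E t + σ t)) (t : ℕ) :
    E t ≤ B * (x * ∑ i ∈ Finset.range (t + 1), x ^ i) := by
  induction t with
  | zero => simpa [mul_comm] using hE0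
  | succ t ih =>
    have hS : 0 ≤ B * (x * ∑ i ∈ Finset.range (t + 1), x ^ i) := by positivity
    calc E (t + 1) ≤ a (t + 1) * (E t + σ t) := hrec t
      _ ≤ a (t + 1) * (B * (x * ∑ i ∈ Finset.range (t + 1), x ^ i) + B) :=
        mul_le_mul_of_nonneg_left (add_le_add ih (hσ t)) (ha _).1
      _ ≤ x * (B * (x * ∑ i ∈ Finset.range (t + 1), x ^ i) + B) :=
        mul_le_mul_of_nonneg_right (ha _).2 (by linarith)
      _ = B * (x * ∑ i ∈ Finset.range (t + 1 + 1), x ^ i) := by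
        rw [geom_sum_succ (n := t + 1)]; ring

/-- Finite-time communication cycle requirement: if the
constant number of cycles `c ≥ 1` satisfies
`c ≥ ln((q_max^{(T+2)c} + ρ/B) / (1 + ρ/B)) / ln(q_max)`,
then the error stays below `ρ` for all `t ≤ T`. -/
theorem finite_time_cycle_requirement
    (T : ℕ) (q σ : ℕ → ℝ) (D0 : ℝ) (hD0 : 0 ≤ D0)
    (hσ : ∀ t, 0 ≤ σ t)
    (qmax B : ℝ) (hqmax : qmax ∈ Set.Ioo (0 : ℝ) 1) (hB : 0 < B)
    (hq : ∀ t, 0 < q t ∧ q t ≤ qmax)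
    (hBD : D0 ≤ B) (hBσ : ∀ t, σ t ≤ B)
    (ρ : ℝ) (hρ : 0 < ρ)
    (c : ℕ) (hc1 : 1 ≤ c)
    (hc : (c : ℝ) ≥ Real.log ((qmax ^ (((T : ℝ) + 2) * (c : ℝ)) + ρ / B) / (1 + ρ / B))
        / Real.log qmax)
    (E : ℕ → ℝ)
    (hE0 : E 0 ≤ q 0 ^ c * D0)
    (hrec : ∀ t, E (t + 1) ≤ q (t + 1) ^ c * (E t + σ t)) :
    ∀ t ≤ T, E t ≤ ρ := by
  obtain ⟨hq0, hq1⟩ := hqmax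
  have ha : ∀ t, 0 ≤ q t ^ c ∧ q t ^ c ≤ qmax ^ c := fun t =>
    ⟨pow_nonneg (hq t).1.le c, pow_le_pow_left₀ (hq t).1.le (hq t).2 c⟩
  have hrpow : qmax ^ (((T : ℝ) + 2) * (c : ℝ)) = (qmax ^ c) ^ (T + 2) := by
    rw [← pow_mul, ← Real.rpow_natCast]
    push_cast
    rw [mul_comm]
  have hx0 : 0 < qmax ^ c := pow_pos hq0 c
  have hx1 : qmax ^ c < 1 := pow_lt_one₀ hq0.le hq1 (by omega)
  have hr : 0 < ρ / B := div_pos hρ hB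
  rw [hrpow, ge_iff_le, div_le_iff_of_neg (Real.log_neg hq0 hq1), ← Real.log_pow,
    Real.log_le_log_iff hx0 (by positivity), le_div_iff₀ (by positivity)] at hc
  have hE0' : E 0 ≤ qmax ^ c * B := hE0.trans (mul_le_mul (ha 0).2 hBD hD0 hx0.le)
  intro t ht
  have hbound := le_mul_geom_sum_of_le_mul_add hx0.le hB.le ha hBσ hE0' hrec t
  generalize qmax ^ c = x at *
  have hmono : ∑ i ∈ Finset.range (t + 1), x ^ i ≤ ∑ i ∈ Finset.range (T + 1), x ^ i :=
    Finset.sum_le_sum_of_subset_of_nonneg (Finset.range_mono (by omega))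
      fun i _ _ => pow_nonneg hx0.le i
  have hgeom := mul_neg_geom_sum x (T + 1)
  have hsum : x * ∑ i ∈ Finset.range (T + 1), x ^ i ≤ ρ / B := by
    refine le_of_mul_le_mul_left ?_ (sub_pos.2 hx1)
    calc (1 - x) * (x * ∑ i ∈ Finset.range (T + 1), x ^ i)
        = x - x ^ (T + 2) := by rw [mul_left_comm, hgeom]; ring
      _ ≤ (1 - x) * (ρ / B) := by linarith
  calc E t ≤ B * (x * ∑ i ∈ Finset.range (t + 1), x ^ i) := hbound
    _ ≤ B * (x * ∑ i ∈ Finset.range (T + 1), x ^ i) := by gcongr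
    _ ≤ B * (ρ / B) := by gcongr
    _ = ρ := mul_div_cancel₀ ρ hB.ne'
end

section
/- Let q : ℕ → ℝ, σ : ℕ → ℝ with σ_t ≥ 0, D₀ ≥ 0, and let q_max ∈ (0, 1) and B > 0 satisfy 0 < q_t ≤ q_max for all t, B ≥ D₀, and B ≥ σ_t for all t. Let ρ > 0 and let c ∈ ℕ with c ≥ 1 satisfy c ≥ ln( (ρ/B) / (1 + ρ/B) ) / ln(q_max). Let E : ℕ → ℝ satisfy E_0 ≤ q_0^{c} · D₀ and E_{t+1} ≤ q_{t+1}^{c} · (E_t + σ_t) for all t. Then E_t ≤ ρ for every t ∈ ℕ. -/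
/-- Asymptotic communication cycle requirement: if the
constant number of cycles `c ≥ 1` satisfies
`c ≥ ln((ρ/B) / (1 + ρ/B)) / ln(q_max)`, then the error stays below `ρ`
for all `t ∈ ℕ`. -/
theorem asymptotic_cycle_requirement
    (q σ : ℕ → ℝ) (D0 : ℝ) (hD0 : 0 ≤ D0)
    (hσ : ∀ t, 0 ≤ σ t)
    (qmax B : ℝ) (hqmax : qmax ∈ Set.Ioo (0 : ℝ) 1) (hB : 0 < B)
    (hq : ∀ t, 0 < q t ∧ q t ≤ qmax)
    (hBD : D0 ≤ B) (hBσ : ∀ t, σ t ≤ B)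
    (ρ : ℝ) (hρ : 0 < ρ)
    (c : ℕ) (hc1 : 1 ≤ c)
    (hc : (c : ℝ) ≥ Real.log ((ρ / B) / (1 + ρ / B)) / Real.log qmax)
    (E : ℕ → ℝ)
    (hE0 : E 0 ≤ q 0 ^ c * D0)
    (hrec : ∀ t, E (t + 1) ≤ q (t + 1) ^ c * (E t + σ t)) :
    ∀ t, E t ≤ ρ := by
  obtain ⟨hq0, hq1⟩ := hqmax
  have hpow : qmax ^ c ≤ (ρ / B) / (1 + ρ / B) := by
    rw [← Real.log_le_log_iff (by positivity) (by positivity), Real.log_pow]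
    exact (div_le_iff_of_neg (Real.log_neg hq0 hq1)).mp hc
  have hfix : qmax ^ c * (ρ + B) ≤ ρ := by
    rw [show (ρ / B) / (1 + ρ / B) = ρ / (ρ + B) by field_simp; ring] at hpow
    exact (le_div_iff₀ (by positivity)).mp hpow
  have hstep : ∀ t x, x ≤ ρ + B → q t ^ c * x ≤ ρ := fun t x hx =>
    calc q t ^ c * x ≤ q t ^ c * (ρ + B) :=
          mul_le_mul_of_nonneg_left hx (pow_nonneg (hq t).1.le c)
      _ ≤ qmax ^ c * (ρ + B) :=
          mul_le_mul_of_nonneg_right (pow_le_pow_left₀ (hq t).1.le (hq t).2 c) (by positivity)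
      _ ≤ ρ := hfix
  intro t
  induction t with
  | zero => exact hE0.trans (hstep 0 D0 (by linarith))
  | succ t ih => exact (hrec t).trans (hstep (t + 1) _ (add_le_add ih (hBσ t)))
end
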